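/- arXiv:1409.6365 — 6 statements merged into one kernel-verified Lean document; each statement's English description precedes it below -/
import Mathlib

section
/- Let n and t be integers with n ≥ t ≥ 1, and let S_n be the star graph with vertex set {1,…,n+1} and edges {n+1,i} for i=1,…,n. Then the vector x ∈ ℝ^{V∪E} defined by x_{n+1} = t/n, x_i = 0 for 1 ≤ i ≤ n, and x_e = t/n for every edge e lies in the polytope P_t(S_n) and has objective value ∑_{i∈V} x_i = t/n; moreover, every 0-1 valued vector in P_t(S_n) has objective value at least 1. Consequently the integrality gap of the t-PVC LP relaxation on S_n is at least n/t. -/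
open Finset

noncomputable section

/-- The star graph `S_n` has vertices `Fin (n+1)` (the leaves are `Fin.castSucc i` for
`i : Fin n`, the center is `Fin.last n`) and its edges are indexed by `Fin n`, edge `i`
joining the center to leaf `i`.  A point of `ℝ^{V ∪ E}` is a function
`Fin (n+1) ⊕ Fin n → ℝ` (`Sum.inl` = vertex coordinates, `Sum.inr` = edge coordinates).
Membership in the `t`-partial-vertex-cover polytope `P_t(S_n)`. -/
def starFeasible (n t : ℕ) (x : Fin (n + 1) ⊕ Fin n → ℝ) : Prop :=
  (∀ i : Fin n,
      x (Sum.inl (Fin.castSucc i)) + x (Sum.inl (Fin.last n)) ≥ x (Sum.inr i)) ∧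
  ((∑ i : Fin n, x (Sum.inr i)) ≥ (t : ℝ)) ∧
  (∀ q : Fin (n + 1) ⊕ Fin n, 0 ≤ x q ∧ x q ≤ 1)

/-- The fractional solution: value `t/n` on the center and on every edge, `0` on leaves. -/
def xstar (n t : ℕ) : Fin (n + 1) ⊕ Fin n → ℝ := fun q =>
  match q with
  | Sum.inl v => if v = Fin.last n then (t : ℝ) / n else 0
  | Sum.inr _ => (t : ℝ) / n

theorem xstar_vertex_sum (n t : ℕ) :
    (∑ v : Fin (n + 1), xstar n t (Sum.inl v)) = (t : ℝ) / n := by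
  simp [xstar]

theorem starFeasible_xstar {n t : ℕ} (hn : 1 ≤ n) (htn : t ≤ n) :
    starFeasible n t (xstar n t) := by
  have hn' : (0 : ℝ) < n := by exact_mod_cast hn
  have h_nonneg : (0 : ℝ) ≤ (t : ℝ) / n := by positivity
  have h_le : (t : ℝ) / n ≤ 1 := (div_le_one hn').2 (by exact_mod_cast htn)
  refine ⟨fun i => ?_, ?_, ?_⟩
  · simp [xstar, (Fin.castSucc_lt_last i).ne]
  · simp [xstar, mul_div_cancel₀ _ hn'.ne']
  · rintro (v | e)
    · by_cases hv : v = Fin.last n <;> simp [xstar, hv, h_nonneg, h_le]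
    · exact ⟨h_nonneg, h_le⟩

theorem one_le_vertex_sum_of_starFeasible {n t : ℕ} (ht : 1 ≤ t)
    {z : Fin (n + 1) ⊕ Fin n → ℝ} (hz : ∀ q, z q = 0 ∨ z q = 1) (hf : starFeasible n t z) :
    (1 : ℝ) ≤ ∑ v : Fin (n + 1), z (Sum.inl v) := by
  obtain ⟨h_edge, h_sum, h_box⟩ := hf
  have ht' : (1 : ℝ) ≤ t := by exact_mod_cast ht
  obtain ⟨i, -, hi⟩ : ∃ i ∈ (Finset.univ : Finset (Fin n)), z (Sum.inr i) ≠ 0 :=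
    Finset.exists_ne_zero_of_sum_ne_zero (by linarith : (0 : ℝ) < _).ne'
  have h_leaf : z (Sum.inl (Fin.castSucc i)) ≤ ∑ j : Fin n, z (Sum.inl (Fin.castSucc j)) :=
    Finset.single_le_sum (f := fun j : Fin n => z (Sum.inl (Fin.castSucc j)))
      (fun j _ => (h_box _).1) (Finset.mem_univ i)
  rw [Fin.sum_univ_castSucc]
  linarith [h_edge i, (hz (Sum.inr i)).resolve_left hi]

theorem stmt0 (n t : ℕ) (ht : 1 ≤ t) (htn : t ≤ n) :
    starFeasible n t (xstar n t) ∧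
    (∑ v : Fin (n + 1), xstar n t (Sum.inl v)) = (t : ℝ) / n ∧
    (∀ z : Fin (n + 1) ⊕ Fin n → ℝ, (∀ q, z q = 0 ∨ z q = 1) → starFeasible n t z →
      (1 : ℝ) ≤ ∑ v : Fin (n + 1), z (Sum.inl v)) ∧
    (∀ z : Fin (n + 1) ⊕ Fin n → ℝ, (∀ q, z q = 0 ∨ z q = 1) → starFeasible n t z →
      (∑ v : Fin (n + 1), z (Sum.inl v)) / (∑ v : Fin (n + 1), xstar n t (Sum.inl v))
        ≥ (n : ℝ) / t) := by
  refine ⟨starFeasible_xstar (ht.trans htn) htn, xstar_vertex_sum n t,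
    fun z hz hf => one_le_vertex_sum_of_starFeasible ht hz hf, fun z hz hf => ?_⟩
  rw [xstar_vertex_sum, ge_iff_le, ← one_div_div]
  exact div_le_div_of_nonneg_right (one_le_vertex_sum_of_starFeasible ht hz hf) (by positivity)

end
end

section
/- Let n and t be integers with n ≥ t ≥ 1, and let G = S_n be the star graph. Every y : P_2 → ℝ with y_∅ = 1 that lies in the level-1 Sherali–Adams tightening S^{(1)}(P_t(G)) satisfies ∑_{i=1}^{n+1} y_{{i}} ≥ 1. Since the minimum size of a t-partial vertex cover of S_n is 1, the level-1 Sherali–Adams tightening of the t-PVC LP has integrality gap 1 on star graphs. -/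
open Finset

noncomputable section

/-- The linearization `w_{Y,N} = ∑_{T ⊆ N} (-1)^{|T|} y_{Y ∪ T}`. -/
def wSA {α : Type*} [DecidableEq α] (y : Finset α → ℝ) (Y N : Finset α) : ℝ :=
  ∑ T ∈ N.powerset, (-1 : ℝ) ^ T.card * y (Y ∪ T)

/-- Membership of `y` (with `y_∅ = 1`) in the level-`r` Sherali–Adams tightening
`S^{(r)}(P_t(S_n))` of the `t`-partial-vertex-cover polytope of the star graph `S_n`
(vertices `Fin (n+1)`, center `Fin.last n`, leaves `Fin.castSucc i`; edge `i : Fin n`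
joins leaf `i` to the center).  Variables are indexed by `Fin (n+1) ⊕ Fin n`
(vertices ⊕ edges). -/
def SAstar (n t r : ℕ) (y : Finset (Fin (n + 1) ⊕ Fin n) → ℝ) : Prop :=
  y ∅ = 1 ∧
  ∀ Y N : Finset (Fin (n + 1) ⊕ Fin n), (Y ∪ N).card ≤ r →
    (∀ i : Fin n,
      wSA y (Y ∪ {Sum.inl (Fin.castSucc i)}) N + wSA y (Y ∪ {Sum.inl (Fin.last n)}) N
        ≥ wSA y (Y ∪ {Sum.inr i}) N) ∧
    ((∑ i : Fin n, wSA y (Y ∪ {Sum.inr i}) N) ≥ (t : ℝ) * wSA y Y N) ∧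
    (∀ q : Fin (n + 1) ⊕ Fin n,
      0 ≤ wSA y (Y ∪ {q}) N ∧ wSA y (Y ∪ {q}) N ≤ wSA y Y N)

theorem wSA_empty {α : Type*} [DecidableEq α] (y : Finset α → ℝ) (Y : Finset α) :
    wSA y Y ∅ = y Y := by
  simp [wSA]

theorem wSA_singleton {α : Type*} [DecidableEq α] (y : Finset α → ℝ) (Y : Finset α) (c : α) :
    wSA y Y {c} = y Y - y (Y ∪ {c}) := by
  have h : ({c} : Finset α).powerset = {∅, {c}} := by
    ext T
    simp [Finset.subset_singleton_iff]
  rw [wSA, h, Finset.sum_pair (Finset.singleton_ne_empty c).symm]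
  simp [sub_eq_add_neg]

theorem stmt2 (n t : ℕ) (ht : 1 ≤ t) (htn : t ≤ n) :
    (∀ y : Finset (Fin (n + 1) ⊕ Fin n) → ℝ, SAstar n t 1 y →
      (1 : ℝ) ≤ ∑ v : Fin (n + 1), y {Sum.inl v}) ∧
    (∃ S : Finset (Fin (n + 1)), S.card = 1 ∧
      t ≤ (Finset.univ.filter
        (fun i : Fin n => Fin.castSucc i ∈ S ∨ Fin.last n ∈ S)).card) := by
  refine ⟨fun y ⟨hy, h⟩ => ?_, {Fin.last n}, by simp, by simpa using htn⟩
  obtain ⟨hedge, hcover, hbox⟩ := h ∅ {Sum.inl (Fin.last n)} (by simp)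
  obtain ⟨-, -, hpair⟩ := h {Sum.inl (Fin.last n)} ∅ (by simp)
  have hcenter := (hbox (Sum.inl (Fin.last n))).1.trans (hbox (Sum.inl (Fin.last n))).2
  simp only [wSA_singleton, Finset.empty_union, Finset.union_idempotent, sub_self,
    add_zero, hy] at hedge hcover hcenter
  have hleaf : ∀ i : Fin n, y {Sum.inr i} - y ({Sum.inr i} ∪ {Sum.inl (Fin.last n)})
      ≤ y {Sum.inl (Fin.castSucc i)} := fun i => by
    have hnonneg := (hpair (Sum.inl (Fin.castSucc i))).1
    rw [wSA_empty, Finset.union_comm] at hnonneg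
    linarith [hedge i]
  have hsum := Finset.sum_le_sum fun i (_ : i ∈ Finset.univ) => hleaf i
  have ht' : (1 : ℝ) ≤ t := by exact_mod_cast ht
  rw [Fin.sum_univ_castSucc]
  linarith [le_mul_of_one_le_left hcenter ht']

end
end

section
/- Let n, r, t be integers with t ≥ 1 and n ≥ 2r+2t+2, and set p = t/C(n−2r,2) where C(m,2) = m(m−1)/2. Consider the complete graph K_n = (V,E) with the random 0-1 assignment D_p: each X_i (i∈V) equals 1 independently with probability p, and for each edge e, X_e = 1 iff at least one endpoint i of e has X_i = 1. Then for all Y, N ⊆ V∪E with |Y∪N| ≤ r: ∑_{e∈E} E[∏_{q∈Y∪{e}} X_q · ∏_{q'∈N}(1−X_{q'})] ≥ t · E[∏_{q∈Y} X_q · ∏_{q'∈N}(1−X_{q'})]. -/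
open Finset
open scoped Classical

noncomputable section

/-- The edges of the complete graph `K_n`: non-diagonal unordered pairs of `Fin n`. -/
abbrev EdgeT (n : ℕ) : Type := {e : Sym2 (Fin n) // ¬ e.IsDiag}

/-- The LP variables of the `t`-PVC relaxation on `K_n`: vertices ⊕ edges. -/
abbrev PVar (n : ℕ) : Type := Fin n ⊕ EdgeT n

/-- The 0-1 assignment determined by a set `S` of chosen vertices: a vertex variable is 1
iff the vertex is chosen, an edge variable is 1 iff the edge has a chosen endpoint. -/
def Xvar (n : ℕ) (q : PVar n) (S : Finset (Fin n)) : ℝ :=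
  match q with
  | Sum.inl i => if i ∈ S then 1 else 0
  | Sum.inr e => if ∃ i ∈ S, i ∈ e.1 then 1 else 0

/-- The probability, under the distribution `D_p` (each vertex chosen independently with
probability `p`), of the set of chosen vertices being exactly `S`. -/
def μD (n : ℕ) (p : ℝ) (S : Finset (Fin n)) : ℝ :=
  p ^ S.card * (1 - p) ^ (n - S.card)

/-- Expectation with respect to `D_p`. -/
def ED (n : ℕ) (p : ℝ) (f : Finset (Fin n) → ℝ) : ℝ :=
  ∑ S : Finset (Fin n), μD n p S * f S

/-- `y_A = Pr_{D_p}[X_q = 1 for all q ∈ A]`. -/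
def yD (n : ℕ) (p : ℝ) (A : Finset (PVar n)) : ℝ :=
  ∑ S : Finset (Fin n), if ∀ q ∈ A, Xvar n q S = 1 then μD n p S else 0

/-- The value `p = t / C(n - 2r, 2)`. -/
def pval (n r t : ℕ) : ℝ := (t : ℝ) / (Nat.choose (n - 2 * r) 2)

/-- The vertices on which the variable `q` depends. -/
def PVar.verts {n : ℕ} (q : PVar n) : Finset (Fin n) :=
  match q with
  | Sum.inl i => {i}
  | Sum.inr e => e.1.toFinset

theorem PVar.card_verts_le {n : ℕ} (q : PVar n) : q.verts.card ≤ 2 := by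
  rcases q with i | e
  · simp [PVar.verts]
  · exact (Sym2.card_toFinset_of_not_isDiag e.1 e.2).le

theorem Xvar_insert_of_notMem_verts {n : ℕ} {q : PVar n} {v : Fin n} (hv : v ∉ q.verts)
    (S : Finset (Fin n)) : Xvar n q (insert v S) = Xvar n q S := by
  rcases q with i | e
  · have hi : i ≠ v := fun h => hv (by simp [PVar.verts, h])
    simp [Xvar, hi]
  · have he : v ∉ e.1 := fun h => hv (Sym2.mem_toFinset.2 h)
    simp [Xvar, he]

theorem Xvar_eq_zero_or_one {n : ℕ} (q : PVar n) (S : Finset (Fin n)) :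
    Xvar n q S = 0 ∨ Xvar n q S = 1 := by
  rcases q with i | e
  · exact (ite_eq_or_eq _ _ _).symm
  · exact (ite_eq_or_eq _ _ _).symm

theorem Xvar_nonneg {n : ℕ} (q : PVar n) (S : Finset (Fin n)) : 0 ≤ Xvar n q S := by
  rcases Xvar_eq_zero_or_one q S with h | h <;> simp [h]

theorem Xvar_le_one {n : ℕ} (q : PVar n) (S : Finset (Fin n)) : Xvar n q S ≤ 1 := by
  rcases Xvar_eq_zero_or_one q S with h | h <;> simp [h]

theorem prod_union_singleton_Xvar {n : ℕ} (Y : Finset (PVar n)) (q : PVar n)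
    (S : Finset (Fin n)) :
    ∏ q' ∈ Y ∪ {q}, Xvar n q' S = Xvar n q S * ∏ q' ∈ Y, Xvar n q' S := by
  by_cases hq : q ∈ Y
  · rw [Finset.union_eq_left.2 (Finset.singleton_subset_iff.2 hq),
      ← Finset.mul_prod_erase Y _ hq, ← mul_assoc]
    rcases Xvar_eq_zero_or_one q S with h | h <;> simp [h]
  · rw [Finset.union_comm, ← Finset.insert_eq, Finset.prod_insert hq]

theorem μD_nonneg {n : ℕ} {p : ℝ} (hp : 0 ≤ p) (hp1 : p ≤ 1) (S : Finset (Fin n)) :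
    0 ≤ μD n p S :=
  mul_nonneg (pow_nonneg hp _) (pow_nonneg (sub_nonneg.2 hp1) _)

theorem ED_mono {n : ℕ} {p : ℝ} (hp : 0 ≤ p) (hp1 : p ≤ 1) {f g : Finset (Fin n) → ℝ}
    (hfg : ∀ S, f S ≤ g S) : ED n p f ≤ ED n p g :=
  Finset.sum_le_sum fun S _ => mul_le_mul_of_nonneg_left (hfg S) (μD_nonneg hp hp1 S)

theorem ED_nonneg {n : ℕ} {p : ℝ} (hp : 0 ≤ p) (hp1 : p ≤ 1) {f : Finset (Fin n) → ℝ}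
    (hf : ∀ S, 0 ≤ f S) : 0 ≤ ED n p f :=
  Finset.sum_nonneg fun S _ => mul_nonneg (μD_nonneg hp hp1 S) (hf S)

/-- A vertex variable is independent of any function not depending on that vertex. -/
theorem ED_inl_mul {n : ℕ} (p : ℝ) (v : Fin n) {f : Finset (Fin n) → ℝ}
    (hf : ∀ S, f (insert v S) = f S) :
    ED n p (fun S => Xvar n (Sum.inl v) S * f S) = p * ED n p f := by
  have hv : v ∉ Finset.univ.erase v := Finset.notMem_erase v _
  have split (g : Finset (Fin n) → ℝ) : ∑ S, g S =
      ∑ S ∈ (Finset.univ.erase v).powerset, (g S + g (insert v S)) := by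
    rw [← Finset.powerset_univ, ← Finset.insert_erase (Finset.mem_univ v),
      Finset.sum_powerset_insert hv, Finset.sum_add_distrib, Finset.insert_erase (Finset.mem_univ v)]
  unfold ED
  rw [split, split, Finset.mul_sum]
  refine Finset.sum_congr rfl fun S hS => ?_
  have hvS : v ∉ S := fun h => hv (Finset.mem_powerset.1 hS h)
  have hlt : S.card < n := by
    simpa using Finset.card_lt_univ_of_notMem hvS
  obtain ⟨k, hk⟩ := Nat.exists_eq_add_of_lt hlt
  have h1 : n - S.card = k + 1 := by omega
  have h2 : n - (S.card + 1) = k := by omega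
  simp only [Xvar, μD, hf, hvS, Finset.mem_insert_self, Finset.card_insert_of_notMem hvS, h1, h2,
    if_true, if_false]
  ring

theorem Xvar_inl_le_inr {n : ℕ} {v : Fin n} {e : EdgeT n} (hv : v ∈ e.1)
    (S : Finset (Fin n)) : Xvar n (Sum.inl v) S ≤ Xvar n (Sum.inr e) S := by
  by_cases hS : v ∈ S
  · have : ∃ i ∈ S, i ∈ e.1 := ⟨v, hS, hv⟩
    simp only [Xvar, if_pos hS, if_pos this, le_refl]
  · simpa [Xvar, hS] using Xvar_nonneg (Sum.inr e) S

theorem choose_two_le_card_edges {n : ℕ} (s : Finset (Fin n)) :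
    s.card.choose 2 ≤
      (Finset.univ.filter fun e : EdgeT n => ∀ v ∈ e.1, v ∈ s).card := by
  rw [← Sym2.card_image_offDiag s,
    ← Finset.card_map (Function.Embedding.subtype fun e : Sym2 (Fin n) => ¬ e.IsDiag)]
  refine Finset.card_le_card fun e he => ?_
  obtain ⟨⟨a, b⟩, hab, rfl⟩ := Finset.mem_image.1 he
  obtain ⟨ha, hb, hne⟩ := Finset.mem_offDiag.1 hab
  have hdiag : ¬ (s(a, b)).IsDiag := by simpa using hne
  refine Finset.mem_map.2 ⟨⟨s(a, b), hdiag⟩, ?_, rfl⟩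
  simp only [Finset.mem_filter, Finset.mem_univ, true_and, Sym2.mem_iff]
  rintro v (rfl | rfl) <;> assumption

theorem stmt4 (n r t : ℕ) (ht : 1 ≤ t) (hn : 2 * r + 2 * t + 2 ≤ n)
    (Y N : Finset (PVar n)) (h : (Y ∪ N).card ≤ r) :
    (∑ e : EdgeT n, ED n (pval n r t) (fun S =>
        (∏ q ∈ Y ∪ {Sum.inr e}, Xvar n q S) * ∏ q' ∈ N, (1 - Xvar n q' S)))
      ≥ (t : ℝ) * ED n (pval n r t) (fun S =>
        (∏ q ∈ Y, Xvar n q S) * ∏ q' ∈ N, (1 - Xvar n q' S)) := by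
  set p := pval n r t
  have hle : t ≤ Nat.choose (n - 2 * r) 2 := by
    calc t ≤ n - 2 * r := by omega
      _ = (n - 2 * r).choose 1 := (Nat.choose_one_right _).symm
      _ ≤ (n - 2 * r).choose 2 := by
          obtain ⟨m, hm⟩ : ∃ m, n - 2 * r = m + 4 := ⟨n - 2 * r - 4, by omega⟩
          rw [hm, Nat.choose_one_right, Nat.choose_two_right, Nat.le_div_iff_mul_le two_pos]
          exact Nat.mul_le_mul_left _ (by omega)
  have hC : (0 : ℝ) < Nat.choose (n - 2 * r) 2 := by exact_mod_cast (by omega : 0 < _)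
  have hp0 : 0 ≤ p := by unfold p pval; positivity
  have hp1 : p ≤ 1 := (div_le_one hC).2 (by exact_mod_cast hle)
  have hpC : (Nat.choose (n - 2 * r) 2 : ℝ) * p = t := mul_div_cancel₀ _ hC.ne'
  set F : Finset (Fin n) → ℝ := fun S =>
    (∏ q ∈ Y, Xvar n q S) * ∏ q' ∈ N, (1 - Xvar n q' S) with hF
  have hF0 (S) : 0 ≤ F S := mul_nonneg (Finset.prod_nonneg fun q _ => Xvar_nonneg q S)
    (Finset.prod_nonneg fun q _ => sub_nonneg.2 (Xvar_le_one q S))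
  simp only [prod_union_singleton_Xvar, mul_assoc]
  change (t : ℝ) * ED n p F ≤ ∑ e : EdgeT n, ED n p fun S => Xvar n (Sum.inr e) S * F S
  set W := (Y ∪ N).biUnion PVar.verts
  have hWcard : W.card ≤ 2 * r :=
    (Finset.card_biUnion_le_card_mul (Y ∪ N) PVar.verts 2 fun q _ => q.card_verts_le).trans
      (by omega)
  have hFW (v) (hv : v ∈ Wᶜ) (S) : F (insert v S) = F S := by
    have hq (q) (hq : q ∈ Y ∪ N) : Xvar n q (insert v S) = Xvar n q S :=
      Xvar_insert_of_notMem_verts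
        (fun h => Finset.mem_compl.1 hv (Finset.mem_biUnion.2 ⟨q, hq, h⟩)) S
    simp only [hF]
    congr 1
    · exact Finset.prod_congr rfl fun q h => hq q (Finset.mem_union_left _ h)
    · exact Finset.prod_congr rfl fun q h => by rw [hq q (Finset.mem_union_right _ h)]
  set T := Finset.univ.filter fun e : EdgeT n => ∀ v ∈ e.1, v ∈ Wᶜ
  have hTcard : Nat.choose (n - 2 * r) 2 ≤ T.card := by
    refine le_trans (Nat.choose_le_choose 2 ?_) (choose_two_le_card_edges Wᶜ)
    rw [Finset.card_compl, Fintype.card_fin]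
    omega
  have hED : 0 ≤ p * ED n p F := mul_nonneg hp0 (ED_nonneg hp0 hp1 hF0)
  calc (t : ℝ) * ED n p F = (Nat.choose (n - 2 * r) 2 : ℝ) * (p * ED n p F) := by
        rw [← mul_assoc, hpC]
    _ ≤ T.card * (p * ED n p F) :=
        mul_le_mul_of_nonneg_right (by exact_mod_cast hTcard) hED
    _ = ∑ e ∈ T, p * ED n p F := by rw [Finset.sum_const, nsmul_eq_mul]
    _ ≤ ∑ e ∈ T, ED n p (fun S => Xvar n (Sum.inr e) S * F S) := by
        refine Finset.sum_le_sum fun e he => ?_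
        have hv : e.1.out.1 ∈ e.1 := Sym2.out_fst_mem e.1
        rw [← ED_inl_mul p _ (hFW _ ((Finset.mem_filter.1 he).2 _ hv))]
        exact ED_mono hp0 hp1 fun S =>
          mul_le_mul_of_nonneg_right (Xvar_inl_le_inr hv S) (hF0 S)
    _ ≤ ∑ e : EdgeT n, ED n p (fun S => Xvar n (Sum.inr e) S * F S) :=
        Finset.sum_le_sum_of_subset_of_nonneg (Finset.subset_univ _) fun e _ _ =>
          ED_nonneg hp0 hp1 fun S => mul_nonneg (Xvar_nonneg _ S) (hF0 S)

end
end

section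
/- Let n, r, t be integers with t ≥ 1 and n ≥ 2r+2t+2, let K_n = (V,E) be the complete graph, and set p = t/C(n−2r,2). Then the vector x ∈ ℝ^{P_1} with x_∅ = 1, x_{{i}} = p for every vertex i ∈ V, and x_{{e}} = 2p−p² for every edge e ∈ E lies in the level-r Lovász–Schrijver SDP tightening N_+^{(r)}(P_t(K_n)). Consequently, the integrality gap of the level-r LS+ tightening of the t-PVC LP on n-vertex graphs is at least C(n−2r,2)/(t·n). -/
open Finset
open scoped Classical

noncomputable section

/-- The number of edges of `K_n` covered by (i.e. incident to) the vertex set `S`. -/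
def covered (n : ℕ) (S : Finset (Fin n)) : ℕ :=
  (Finset.univ.filter (fun e : EdgeT n => ∃ i ∈ S, i ∈ e.1)).card

/-- The Lovász–Schrijver cones `K^{(r)}` over the homogenized `t`-PVC polytope of `K_n`.
Points are indexed by `P_1` (encoded as `Option (PVar n)`: `none` is the index `∅`,
`some q` the singleton `{q}`).  `K^{(0)}` consists of the homogenized constraints; the
inductive step asks for a PSD moment matrix `M` indexed by `P_1` (symmetry is part of
positive semidefiniteness, and the diagonal condition `M_{{q},{q}} = M_{{q},∅}` makes
`M` the moment matrix of some `y ∈ ℝ^{P_2}`) whose column at `∅` is `x` and whose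
columns `M e_{{q}}` and `M (e_∅ - e_{{q}})` lie in `K^{(r-1)}`. -/
def Kcone (n t : ℕ) : ℕ → (Option (PVar n) → ℝ) → Prop
  | 0, x =>
      0 ≤ x none ∧
      (∀ (e : EdgeT n) (i j : Fin n), e.1 = s(i, j) →
        x (some (Sum.inl i)) + x (some (Sum.inl j)) ≥ x (some (Sum.inr e))) ∧
      ((∑ e : EdgeT n, x (some (Sum.inr e))) ≥ (t : ℝ) * x none) ∧
      (∀ q : PVar n, 0 ≤ x (some q) ∧ x (some q) ≤ x none)
  | r + 1, x => ∃ M : Matrix (Option (PVar n)) (Option (PVar n)) ℝ,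
      M.PosSemidef ∧
      (∀ q : PVar n, M (some q) (some q) = M (some q) none) ∧
      (∀ A, M A none = x A) ∧
      ∀ q : PVar n, Kcone n t r (fun A => M A (some q)) ∧
                    Kcone n t r (fun A => M A none - M A (some q))

/-- The proposed point: `x_∅ = 1`, `x_{{i}} = p` for vertices, `x_{{e}} = 2p - p²` for
edges. -/
def xLS (n : ℕ) (p : ℝ) : Option (PVar n) → ℝ := fun A =>
  match A with
  | none => 1
  | some (Sum.inl _) => p
  | some (Sum.inr _) => 2 * p - p ^ 2

theorem Kcone.add {n t : ℕ} : ∀ {r : ℕ} {x y : Option (PVar n) → ℝ},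
    Kcone n t r x → Kcone n t r y → Kcone n t r (fun A => x A + y A)
  | 0, x, y, hx, hy => by
    obtain ⟨hx0, hxe, hxt, hxb⟩ := hx
    obtain ⟨hy0, hye, hyt, hyb⟩ := hy
    refine ⟨add_nonneg hx0 hy0, fun e i j h => ?_, ?_, fun q => ?_⟩
    · linarith [hxe e i j h, hye e i j h]
    · rw [sum_add_distrib]
      linarith
    · constructor <;> linarith [hxb q, hyb q]
  | r + 1, x, y, hx, hy => by
    obtain ⟨M, hM, hMd, hMx, hMc⟩ := hx
    obtain ⟨N, hN, hNd, hNy, hNc⟩ := hy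
    refine ⟨M + N, hM.add hN, fun q => ?_, fun A => ?_, fun q => ⟨?_, ?_⟩⟩
    · simp [hMd, hNd]
    · simp [hMx, hNy]
    · exact Kcone.add (hMc q).1 (hNc q).1
    · convert Kcone.add (hMc q).2 (hNc q).2 using 2
      simp only [Matrix.add_apply]
      ring

theorem Kcone.smul {n t : ℕ} {c : ℝ} (hc : 0 ≤ c) : ∀ {r : ℕ} {x : Option (PVar n) → ℝ},
    Kcone n t r x → Kcone n t r (fun A => c * x A)
  | 0, x, hx => by
    obtain ⟨hx0, hxe, hxt, hxb⟩ := hx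
    refine ⟨mul_nonneg hc hx0, fun e i j h => ?_, ?_, fun q =>
      ⟨mul_nonneg hc (hxb q).1, mul_le_mul_of_nonneg_left (hxb q).2 hc⟩⟩
    · rw [← mul_add]
      exact mul_le_mul_of_nonneg_left (hxe e i j h) hc
    · rw [← mul_sum, mul_left_comm]
      exact mul_le_mul_of_nonneg_left hxt hc
  | r + 1, x, hx => by
    obtain ⟨M, hM, hMd, hMx, hMc⟩ := hx
    refine ⟨c • M, hM.smul hc, fun q => ?_, fun A => ?_, fun q => ⟨?_, ?_⟩⟩
    · simp [hMd]
    · simp [hMx]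
    · exact Kcone.smul hc (hMc q).1
    · convert Kcone.smul hc (hMc q).2 using 2
      simp only [Matrix.smul_apply, smul_eq_mul]
      ring

/-- The integral solution given by a vertex set `S`: an edge is covered when it meets `S`. -/
def coverVec {n : ℕ} (S : Finset (Fin n)) : Option (PVar n) → ℝ
  | none => 1
  | some (Sum.inl i) => if i ∈ S then 1 else 0
  | some (Sum.inr e) => if ∃ i ∈ S, i ∈ e.1 then 1 else 0

/-- The probability of `S` when each vertex `i` is picked independently with probability `π i`. -/
def bernoulliWeight {n : ℕ} (π : Fin n → ℝ) (S : Finset (Fin n)) : ℝ :=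
  ∏ i, if i ∈ S then π i else 1 - π i

/-- The expectation of `coverVec` under independent vertex sampling. -/
def bernoulliPoint {n : ℕ} (π : Fin n → ℝ) (A : Option (PVar n)) : ℝ :=
  ∑ S, bernoulliWeight π S * coverVec S A

section Bernoulli

variable {n : ℕ} {π : Fin n → ℝ}

theorem bernoulliWeight_nonneg (hπ : ∀ i, π i ∈ Set.Icc (0 : ℝ) 1) (S : Finset (Fin n)) :
    0 ≤ bernoulliWeight π S := by
  refine prod_nonneg fun i _ => ?_
  split_ifs
  · exact (hπ i).1
  · exact sub_nonneg.2 (hπ i).2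

theorem sum_bernoulliWeight (π : Fin n → ℝ) : ∑ S, bernoulliWeight π S = 1 := by
  have h := prod_add π (fun i => 1 - π i) univ
  simp only [add_sub_cancel, prod_const_one, powerset_univ] at h
  rw [h]
  refine sum_congr rfl fun S _ => ?_
  rw [bernoulliWeight, prod_ite]
  congr 2 <;> ext <;> simp

theorem bernoulliWeight_mul_mem (π : Fin n → ℝ) (S : Finset (Fin n)) (i : Fin n) :
    bernoulliWeight π S * (if i ∈ S then 1 else 0)
      = π i * bernoulliWeight (Function.update π i 1) S := by
  have h : ∀ σ : Fin n → ℝ, bernoulliWeight σ S =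
      (if i ∈ S then σ i else 1 - σ i) *
        ∏ j ∈ univ.erase i, if j ∈ S then σ j else 1 - σ j := fun σ =>
    (mul_prod_erase univ _ (mem_univ i)).symm
  have h' : (∏ j ∈ univ.erase i, if j ∈ S then Function.update π i 1 j
      else 1 - Function.update π i 1 j) = ∏ j ∈ univ.erase i, if j ∈ S then π j else 1 - π j :=
    prod_congr rfl fun j hj => by rw [Function.update_of_ne (ne_of_mem_erase hj)]
  rw [h π, h (Function.update π i 1), h', Function.update_self]
  split_ifs <;> ring

theorem bernoulliWeight_mul_notMem (π : Fin n → ℝ) (S : Finset (Fin n)) (i : Fin n) :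
    bernoulliWeight π S * (1 - if i ∈ S then 1 else 0)
      = (1 - π i) * bernoulliWeight (Function.update π i 0) S := by
  have h : ∀ σ : Fin n → ℝ, bernoulliWeight σ S =
      (if i ∈ S then σ i else 1 - σ i) *
        ∏ j ∈ univ.erase i, if j ∈ S then σ j else 1 - σ j := fun σ =>
    (mul_prod_erase univ _ (mem_univ i)).symm
  have h' : (∏ j ∈ univ.erase i, if j ∈ S then Function.update π i 0 j
      else 1 - Function.update π i 0 j) = ∏ j ∈ univ.erase i, if j ∈ S then π j else 1 - π j :=
    prod_congr rfl fun j hj => by rw [Function.update_of_ne (ne_of_mem_erase hj)]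
  rw [h π, h (Function.update π i 0), h', Function.update_self]
  split_ifs <;> ring

theorem coverVec_edge (S : Finset (Fin n)) {e : EdgeT n} {i j : Fin n} (he : e.1 = s(i, j)) :
    coverVec S (some (Sum.inr e)) = (if i ∈ S then 1 else 0)
      + (1 - if i ∈ S then 1 else 0) * (if j ∈ S then 1 else 0) := by
  have h : (∃ k ∈ S, k ∈ e.1) ↔ i ∈ S ∨ j ∈ S := by
    simp only [he, Sym2.mem_iff]
    constructor
    · rintro ⟨k, hk, rfl | rfl⟩ <;> simp [hk]
    · rintro (h | h)
      exacts [⟨i, h, .inl rfl⟩, ⟨j, h, .inr rfl⟩]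
  simp only [coverVec, h]
  by_cases hi : i ∈ S <;> by_cases hj : j ∈ S <;> simp [hi, hj]

theorem coverVec_mem_Icc (S : Finset (Fin n)) (A : Option (PVar n)) :
    coverVec S A ∈ Set.Icc (0 : ℝ) 1 := by
  rcases A with _ | _ | _ <;> simp only [coverVec]
  · simp
  all_goals split_ifs <;> simp

theorem coverVec_mul_self (S : Finset (Fin n)) (A : Option (PVar n)) :
    coverVec S A * coverVec S A = coverVec S A := by
  rcases A with _ | _ | _ <;> simp [coverVec]

theorem bernoulliPoint_none (π : Fin n → ℝ) : bernoulliPoint π none = 1 := by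
  simp [bernoulliPoint, coverVec, sum_bernoulliWeight]

theorem bernoulliPoint_vertex (π : Fin n → ℝ) (i : Fin n) :
    bernoulliPoint π (some (Sum.inl i)) = π i := by
  simp only [bernoulliPoint, coverVec, bernoulliWeight_mul_mem, ← mul_sum, sum_bernoulliWeight,
    mul_one]

theorem sum_mul_vertex (π : Fin n → ℝ) (i : Fin n) (A : Option (PVar n)) :
    ∑ S, bernoulliWeight π S * (coverVec S A * coverVec S (some (Sum.inl i)))
      = π i * bernoulliPoint (Function.update π i 1) A := by
  rw [bernoulliPoint, mul_sum]
  refine sum_congr rfl fun S _ => ?_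
  rw [← mul_assoc (π i), ← bernoulliWeight_mul_mem]
  simp only [coverVec]
  ring

theorem sum_mul_one_sub_vertex (π : Fin n → ℝ) (i : Fin n) (A : Option (PVar n)) :
    ∑ S, bernoulliWeight π S * (coverVec S A * (1 - coverVec S (some (Sum.inl i))))
      = (1 - π i) * bernoulliPoint (Function.update π i 0) A := by
  rw [bernoulliPoint, mul_sum]
  refine sum_congr rfl fun S _ => ?_
  rw [← mul_assoc (1 - π i), ← bernoulliWeight_mul_notMem]
  simp only [coverVec]
  ring

theorem sum_mul_edge (π : Fin n → ℝ) {e : EdgeT n} {i j : Fin n} (he : e.1 = s(i, j))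
    (A : Option (PVar n)) :
    ∑ S, bernoulliWeight π S * (coverVec S A * coverVec S (some (Sum.inr e)))
      = π i * bernoulliPoint (Function.update π i 1) A
        + (1 - π i) * (Function.update π i 0 j *
          bernoulliPoint (Function.update (Function.update π i 0) j 1) A) := by
  rw [← sum_mul_vertex, ← sum_mul_vertex, mul_sum, ← sum_add_distrib]
  refine sum_congr rfl fun S _ => ?_
  rw [← mul_assoc (1 - π i), ← bernoulliWeight_mul_notMem, coverVec_edge S he]
  simp only [coverVec]
  ring

theorem sum_mul_one_sub_edge (π : Fin n → ℝ) {e : EdgeT n} {i j : Fin n} (he : e.1 = s(i, j))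
    (A : Option (PVar n)) :
    ∑ S, bernoulliWeight π S * (coverVec S A * (1 - coverVec S (some (Sum.inr e))))
      = (1 - π i) * ((1 - Function.update π i 0 j) *
          bernoulliPoint (Function.update (Function.update π i 0) j 0) A) := by
  rw [← sum_mul_one_sub_vertex, mul_sum]
  refine sum_congr rfl fun S _ => ?_
  rw [← mul_assoc (1 - π i), ← bernoulliWeight_mul_notMem, coverVec_edge S he]
  simp only [coverVec]
  ring

theorem bernoulliPoint_edge (π : Fin n → ℝ) {e : EdgeT n} {i j : Fin n} (he : e.1 = s(i, j)) :
    bernoulliPoint π (some (Sum.inr e)) = π i + (1 - π i) * π j := by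
  have hij : j ≠ i := fun h => e.2 (by rw [he, h]; exact Sym2.mk_isDiag_iff.2 rfl)
  have h := sum_mul_edge π he none
  simp only [bernoulliPoint_none, Function.update_of_ne hij, mul_one] at h
  rw [← h, bernoulliPoint]
  simp [coverVec]

theorem choose_card_le_card_edges (F : Finset (Fin n)) :
    (#F).choose 2 ≤ #{e : EdgeT n | ∀ i ∈ e.1, i ∈ F} := by
  rw [← Sym2.card_image_offDiag, ← card_map (Function.Embedding.subtype _)]
  refine card_le_card fun e he => ?_
  simp only [mem_image, mem_offDiag, Prod.exists] at he
  obtain ⟨i, j, ⟨hi, hj, hij⟩, rfl⟩ := he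
  simp only [mem_map, mem_filter, mem_univ, true_and]
  refine ⟨⟨s(i, j), by simpa using hij⟩, fun k hk => ?_, rfl⟩
  rcases Sym2.mem_iff.1 hk with rfl | rfl <;> assumption

theorem Kcone_zero_bernoulliPoint {t m : ℕ} {p : ℝ} (hp : (t : ℝ) ≤ p * (n - m).choose 2)
    (hp0 : 0 ≤ p) (hπ : ∀ i, π i ∈ Set.Icc (0 : ℝ) 1) (hm : #{i | π i ≠ p} ≤ m) :
    Kcone n t 0 (bernoulliPoint π) := by
  have hedge : ∀ {e : EdgeT n} {i j : Fin n}, e.1 = s(i, j) →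
      π i ≤ bernoulliPoint π (some (Sum.inr e)) := fun {e i j} he => by
    rw [bernoulliPoint_edge π he]
    nlinarith [mul_nonneg (sub_nonneg.2 (hπ i).2) (hπ j).1]
  have hnonneg : ∀ A, 0 ≤ bernoulliPoint π A := fun A => sum_nonneg fun S _ =>
    mul_nonneg (bernoulliWeight_nonneg hπ S) (coverVec_mem_Icc S A).1
  refine ⟨hnonneg none, fun e i j he => ?_, ?_, fun q => ⟨hnonneg _, ?_⟩⟩
  · rw [bernoulliPoint_edge π he, bernoulliPoint_vertex, bernoulliPoint_vertex]
    nlinarith [mul_nonneg (hπ i).1 (hπ j).1]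
  · have hF : n - m ≤ #{i | π i = p} := by
      have := card_filter_add_card_filter_not (s := (univ : Finset (Fin n))) (fun i => π i = p)
      rw [card_univ, Fintype.card_fin] at this
      simp only [ne_eq] at hm
      omega
    rw [bernoulliPoint_none, mul_one, ge_iff_le]
    calc (t : ℝ) ≤ p * (n - m).choose 2 := hp
      _ ≤ p * #{e : EdgeT n | ∀ i ∈ e.1, i ∈ ({i | π i = p} : Finset (Fin n))} := by
        gcongr
        exact (Nat.choose_le_choose 2 hF).trans (choose_card_le_card_edges _)
      _ = ∑ e : EdgeT n with ∀ i ∈ e.1, i ∈ ({i | π i = p} : Finset (Fin n)), p := by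
        rw [sum_const, nsmul_eq_mul, mul_comm]
      _ ≤ ∑ e : EdgeT n with ∀ i ∈ e.1, i ∈ ({i | π i = p} : Finset (Fin n)),
          bernoulliPoint π (some (Sum.inr e)) := by
        refine sum_le_sum fun e he => ?_
        obtain ⟨⟨i, j⟩, hij⟩ := e.1.mk_surjective
        have hi := (mem_filter.1 ((mem_filter.1 he).2 i (hij ▸ Sym2.mem_mk_left i j))).2
        exact hi ▸ hedge hij.symm
      _ ≤ _ := sum_le_sum_of_subset_of_nonneg (filter_subset _ _) fun e _ _ => hnonneg _
  · refine sum_le_sum fun S _ => mul_le_mul_of_nonneg_left ?_ (bernoulliWeight_nonneg hπ S)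
    exact (coverVec_mem_Icc S _).2

theorem update_mem_Icc (hπ : ∀ i, π i ∈ Set.Icc (0 : ℝ) 1) (i : Fin n) {c : ℝ}
    (hc : c ∈ Set.Icc (0 : ℝ) 1) (j : Fin n) : Function.update π i c j ∈ Set.Icc (0 : ℝ) 1 := by
  rcases eq_or_ne j i with rfl | h
  · simpa using hc
  · simpa [h] using hπ j

theorem card_update_ne_le (π : Fin n → ℝ) (i : Fin n) (c p : ℝ) :
    #{j | Function.update π i c j ≠ p} ≤ #{j | π j ≠ p} + 1 := by
  refine (card_le_card fun j hj => ?_).trans (card_insert_le i _)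
  rcases eq_or_ne j i with rfl | h
  · simp
  · simpa [h] using hj

theorem Kcone_bernoulliPoint {t m : ℕ} {p : ℝ} (hp : (t : ℝ) ≤ p * (n - m).choose 2)
    (hp0 : 0 ≤ p) (r : ℕ) : ∀ π : Fin n → ℝ, (∀ i, π i ∈ Set.Icc (0 : ℝ) 1) →
      #{i | π i ≠ p} + 2 * r ≤ m → Kcone n t r (bernoulliPoint π) := by
  induction r with
  | zero => exact fun π hπ hm => Kcone_zero_bernoulliPoint hp hp0 hπ hm
  | succ r ih =>
    intro π hπ hm
    have h0 : (0 : ℝ) ∈ Set.Icc (0 : ℝ) 1 := by simp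
    have h1 : (1 : ℝ) ∈ Set.Icc (0 : ℝ) 1 := by simp
    have one_update : ∀ i, ∀ c ∈ Set.Icc (0 : ℝ) 1,
        Kcone n t r (bernoulliPoint (Function.update π i c)) := fun i c hc =>
      ih _ (update_mem_Icc hπ i hc) (by have := card_update_ne_le π i c p; omega)
    have two_updates : ∀ i j, ∀ c ∈ Set.Icc (0 : ℝ) 1, ∀ d ∈ Set.Icc (0 : ℝ) 1,
        Kcone n t r (bernoulliPoint (Function.update (Function.update π i c) j d)) :=
      fun i j c hc d hd => ih _ (update_mem_Icc (update_mem_Icc hπ i hc) j hd) (by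
        have := card_update_ne_le π i c p
        have := card_update_ne_le (Function.update π i c) j d p
        omega)
    have happ : ∀ A B, (∑ S, bernoulliWeight π S •
        Matrix.vecMulVec (coverVec S) (star (coverVec S))) A B =
          ∑ S, bernoulliWeight π S * (coverVec S A * coverVec S B) := fun A B => by
      simp [Matrix.sum_apply, Matrix.vecMulVec_apply]
    have hnone : ∀ A, ∑ S, bernoulliWeight π S * (coverVec S A * coverVec S none) =
        bernoulliPoint π A := fun A => by simp [bernoulliPoint, coverVec]
    have hsub : ∀ A q, bernoulliPoint π A -
        ∑ S, bernoulliWeight π S * (coverVec S A * coverVec S (some q)) =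
          ∑ S, bernoulliWeight π S * (coverVec S A * (1 - coverVec S (some q))) := fun A q => by
      rw [bernoulliPoint, ← sum_sub_distrib]
      exact sum_congr rfl fun S _ => by ring
    refine ⟨∑ S, bernoulliWeight π S • Matrix.vecMulVec (coverVec S) (star (coverVec S)),
      Matrix.posSemidef_sum _ fun S _ =>
        (Matrix.posSemidef_vecMulVec_self_star _).smul (bernoulliWeight_nonneg hπ S),
      fun q => ?_, fun A => ?_, fun q => ?_⟩
    · rw [happ, happ, hnone]
      simp only [coverVec_mul_self, bernoulliPoint]
    · rw [happ, hnone]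
    · simp only [happ, hnone, hsub]
      rcases q with i | e
      · simp only [sum_mul_vertex, sum_mul_one_sub_vertex]
        exact ⟨(one_update i 1 h1).smul (hπ i).1,
          (one_update i 0 h0).smul (sub_nonneg.2 (hπ i).2)⟩
      · obtain ⟨⟨i, j⟩, hij⟩ := e.1.mk_surjective
        have hj := update_mem_Icc hπ i h0 j
        simp only [sum_mul_edge π hij.symm, sum_mul_one_sub_edge π hij.symm]
        exact ⟨((one_update i 1 h1).smul (hπ i).1).add
            (((two_updates i j 0 h0 1 h1).smul hj.1).smul (sub_nonneg.2 (hπ i).2)),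
          ((two_updates i j 0 h0 0 h0).smul (sub_nonneg.2 hj.2)).smul (sub_nonneg.2 (hπ i).2)⟩

theorem bernoulliPoint_const (p : ℝ) : bernoulliPoint (fun _ : Fin n => p) = xLS n p := by
  funext A
  rcases A with _ | i | e
  · exact bernoulliPoint_none _
  · exact bernoulliPoint_vertex _ i
  · obtain ⟨⟨i, j⟩, hij⟩ := e.1.mk_surjective
    rw [bernoulliPoint_edge _ hij.symm, xLS]
    ring

end Bernoulli

theorem le_choose_two {n r t : ℕ} (hn : 2 * r + 2 * t + 2 ≤ n) :
    t + 1 ≤ (n - 2 * r).choose 2 := by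
  refine le_trans ?_ (Nat.choose_le_choose 2 (show t + 2 ≤ n - 2 * r by omega))
  rw [Nat.choose_succ_succ' (t + 1) 1, Nat.choose_one_right]
  exact Nat.le_add_right _ _

theorem stmt9 (n r t : ℕ) (ht : 1 ≤ t) (hn : 2 * r + 2 * t + 2 ≤ n) :
    (Kcone n t r (xLS n (pval n r t)) ∧ xLS n (pval n r t) none = 1) ∧
    (∀ S : Finset (Fin n), t ≤ covered n S →
      ((Nat.choose (n - 2 * r) 2 : ℝ)) / ((t : ℝ) * n)
        ≤ (S.card : ℝ) / (∑ i : Fin n, xLS n (pval n r t) (some (Sum.inl i)))) := by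
  have hC : (t : ℝ) + 1 ≤ (n - 2 * r).choose 2 := by exact_mod_cast le_choose_two hn
  have ht' : (1 : ℝ) ≤ t := by exact_mod_cast ht
  have hC0 : (0 : ℝ) < (n - 2 * r).choose 2 := by linarith
  have hp0 : 0 ≤ pval n r t := by unfold pval; positivity
  have hp1 : pval n r t ≤ 1 := (div_le_one hC0).2 (by linarith)
  refine ⟨⟨?_, rfl⟩, fun S hS => ?_⟩
  · rw [← bernoulliPoint_const]
    refine Kcone_bernoulliPoint (m := 2 * r) (p := pval n r t) ?_ hp0 r _
      (fun _ => ⟨hp0, hp1⟩) (by simp)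
    rw [pval, div_mul_cancel₀ _ hC0.ne']
  · have hS1 : (1 : ℝ) ≤ #S := by
      rw [Nat.one_le_cast, Nat.one_le_iff_ne_zero, card_ne_zero]
      by_contra h
      rw [not_nonempty_iff_eq_empty] at h
      subst h
      simp [covered] at hS
      omega
    have hn0 : (0 : ℝ) < n := by exact_mod_cast (by omega : 0 < n)
    have hsum : (∑ i : Fin n, xLS n (pval n r t) (some (Sum.inl i))) = n * pval n r t := by
      simp [xLS]
    rw [hsum, pval, ← mul_div_assoc, div_div_eq_mul_div, mul_comm (n : ℝ)]
    gcongr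
    exact le_mul_of_one_le_left hC0.le hS1

end
end

section
/- Fix integers r ≥ 0 and t ≥ 1. For all sufficiently large n the following holds: let K_n = (V,E), p = t/C(n−2r,2), and y_A = Pr_{D_p}[X_q = 1 for all q ∈ A] for A ⊆ V∪E. Then the symmetric matrix Z̄, indexed by subsets I, J ⊆ V of size at most 1, with entries Z̄_{I,J} = ∑_{e∈E} y_{I∪J∪{e}} − t·y_{I∪J}, is not positive semidefinite. Consequently the level-1 Lasserre SDP (which requires the slack moment matrix of the demand constraint ∑_{e∈E} x_e ≥ t to be positive semidefinite) eliminates the Sherali–Adams solution y. -/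
open Finset
open scoped Classical

noncomputable section

/-- The number of edges with an endpoint in `S`. -/
def coveredCount (n : ℕ) (S : Finset (Fin n)) : ℝ :=
  ∑ e : EdgeT n, Xvar n (Sum.inr e) S

lemma Xvar_eq_ite (n : ℕ) (q : PVar n) (S : Finset (Fin n)) :
    Xvar n q S = if Xvar n q S = 1 then 1 else 0 := by
  rcases q with i | e <;> simp only [Xvar] <;> split_ifs <;> simp_all

lemma prod_Xvar_eq_ite (n : ℕ) (A : Finset (PVar n)) (S : Finset (Fin n)) :
    ∏ q ∈ A, Xvar n q S = if ∀ q ∈ A, Xvar n q S = 1 then 1 else 0 := by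
  rw [prod_congr rfl fun q _ => Xvar_eq_ite n q S, prod_boole]
  congr

lemma yD_eq_ED_prod (n : ℕ) (p : ℝ) (A : Finset (PVar n)) :
    yD n p A = ED n p fun S => ∏ q ∈ A, Xvar n q S :=
  sum_congr rfl fun S _ => by simp [prod_Xvar_eq_ite]

lemma prod_Xvar_union (n : ℕ) (A B : Finset (PVar n)) (S : Finset (Fin n)) :
    ∏ q ∈ A ∪ B, Xvar n q S = (∏ q ∈ A, Xvar n q S) * ∏ q ∈ B, Xvar n q S := by
  simp only [prod_Xvar_eq_ite, forall_mem_union]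
  split_ifs <;> simp_all

lemma prod_Xvar_image_inl (n : ℕ) (I S : Finset (Fin n)) :
    ∏ q ∈ I.image (Sum.inl : Fin n → PVar n), Xvar n q S = if I ⊆ S then 1 else 0 := by
  rw [prod_image Sum.inl_injective.injOn]
  simp only [Xvar, prod_boole, subset_iff]
  congr

lemma slack_entry_eq (n : ℕ) (p t : ℝ) (I J : Finset (Fin n)) :
    (∑ e : EdgeT n, yD n p ((I.image (Sum.inl : Fin n → PVar n)
        ∪ J.image (Sum.inl : Fin n → PVar n)) ∪ {Sum.inr e}))
      - t * yD n p (I.image (Sum.inl : Fin n → PVar n) ∪ J.image (Sum.inl : Fin n → PVar n))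
    = ED n p fun S => (coveredCount n S - t)
        * ((if I ⊆ S then 1 else 0) * (if J ⊆ S then 1 else 0)) := by
  simp only [yD_eq_ED_prod, prod_Xvar_union, prod_Xvar_image_inl, prod_singleton, ED,
    coveredCount]
  rw [sum_comm, mul_sum, ← sum_sub_distrib]
  refine sum_congr rfl fun S _ => ?_
  rw [← mul_sum, ← mul_sum]
  ring

lemma sum_card_le_one_subset (n : ℕ) (S : Finset (Fin n)) :
    ∑ I : {I : Finset (Fin n) // I.card ≤ 1},
      (1 - 2 * (I.1.card : ℝ)) * (if I.1 ⊆ S then 1 else 0) = 1 - S.card := by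
  have h : (univ.filter fun I : Finset (Fin n) => I.card ≤ 1)
      = powersetCard 0 univ ∪ powersetCard 1 univ := by
    ext I
    simp only [mem_filter, mem_univ, true_and, mem_union, mem_powersetCard, subset_univ]
    omega
  have hdisj : Disjoint (powersetCard 0 (univ : Finset (Fin n))) (powersetCard 1 univ) :=
    pairwise_disjoint_powersetCard _ zero_ne_one
  rw [← sum_subtype (univ.filter fun I : Finset (Fin n) => I.card ≤ 1) (by simp)
      fun I => (1 - 2 * (I.card : ℝ)) * (if I ⊆ S then 1 else 0),
    h, sum_union hdisj, powersetCard_zero, sum_singleton, powersetCard_one, sum_map]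
  norm_num [sub_eq_add_neg]

lemma quadratic_form_ED {ι : Type*} [Fintype ι] (n : ℕ) (p : ℝ) (w : Finset (Fin n) → ℝ)
    (u : ι → Finset (Fin n) → ℝ) (x : ι → ℝ) :
    ∑ i, x i * ∑ j, ED n p (fun S => w S * (u i S * u j S)) * x j
      = ED n p fun S => w S * (∑ i, x i * u i S) ^ 2 := by
  simp only [ED, sq, sum_mul_sum]
  simp only [mul_sum, sum_mul]
  rw [sum_comm_cycle]
  refine sum_congr rfl fun S _ => sum_congr rfl fun i _ => sum_congr rfl fun j _ => ?_
  ring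

lemma coveredCount_le (n : ℕ) (S : Finset (Fin n)) : coveredCount n S ≤ S.card * n := by
  have hstar (i : Fin n) : (univ.filter fun e : EdgeT n => i ∈ e.1).card ≤ n := by
    calc (univ.filter fun e : EdgeT n => i ∈ e.1).card
        = ((univ.filter fun e : EdgeT n => i ∈ e.1).image Subtype.val).card :=
          (card_image_of_injective _ Subtype.val_injective).symm
      _ ≤ (univ.image fun j : Fin n => s(i, j)).card := by
          refine card_le_card fun e he => ?_
          simp only [mem_image, mem_filter, mem_univ, true_and] at he ⊢
          obtain ⟨e, hi, rfl⟩ := he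
          obtain ⟨j, hj⟩ := hi
          exact ⟨j, hj.symm⟩
      _ ≤ n := card_image_le.trans (by simp)
  have h : coveredCount n S
      = ((S.biUnion fun i => univ.filter fun e : EdgeT n => i ∈ e.1).card : ℝ) := by
    have : (S.biUnion fun i => univ.filter fun e : EdgeT n => i ∈ e.1)
        = univ.filter fun e : EdgeT n => ∃ i ∈ S, i ∈ e.1 := by
      ext e
      simp
    rw [this]
    simp only [coveredCount, Xvar, sum_boole]
  rw [h]
  exact_mod_cast card_biUnion_le_card_mul _ _ _ fun i _ => hstar i

lemma mul_sub_one_sq_mul_sq_le_pow {n : ℝ} (hn : 6 ≤ n) (k : ℕ) :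
    (k : ℝ) * (1 - k) ^ 2 * n ^ 2 ≤ 2 * n ^ k := by
  match k with
  | 0 => simp
  | 1 => simp; linarith
  | k + 2 =>
    have h : ((k : ℝ) + 2) * (k + 1) ^ 2 ≤ 2 * n ^ k := by
      induction k with
      | zero => norm_num
      | succ k ih =>
        have hk : (0 : ℝ) ≤ k := k.cast_nonneg
        have hp : 0 ≤ n ^ k := by positivity
        have hmul := mul_nonneg hp (sub_nonneg.2 hn)
        have hpoly : ((k : ℝ) + 1 + 2) * (k + 1 + 1) ^ 2 ≤ 6 * ((k + 2) * (k + 1) ^ 2) := by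
          nlinarith [mul_nonneg hk hk, mul_nonneg (mul_nonneg hk hk) hk]
        rw [pow_succ n]
        push_cast
        linarith
    rw [pow_add, ← mul_assoc]
    refine mul_le_mul_of_nonneg_right (le_of_eq_of_le ?_ h) (sq_nonneg n)
    push_cast
    ring

lemma ED_pow_card (n : ℕ) (p z : ℝ) :
    ED n p (fun S => z ^ S.card) = (1 + p * (z - 1)) ^ n := by
  have h := Fintype.sum_pow_mul_eq_add_pow (Fin n) (p * z) (1 - p)
  rw [Fintype.card_fin] at h
  rw [show 1 + p * (z - 1) = p * z + (1 - p) by ring, ← h]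
  refine sum_congr rfl fun S _ => ?_
  rw [μD, mul_pow]
  ring

lemma ED_slack_le {n : ℕ} (hn : 6 ≤ n) {p t : ℝ} (hp0 : 0 ≤ p) (hp1 : p ≤ 1) (ht : 0 ≤ t) :
    ED n p (fun S => (coveredCount n S - t) * (1 - S.card) ^ 2)
      ≤ 2 / n * (1 + p * (n - 1)) ^ n - t * (1 - p) ^ n := by
  have hn' : (6 : ℝ) ≤ n := by exact_mod_cast hn
  have hempty : ED n p (fun S => if S = ∅ then t else 0) = t * (1 - p) ^ n := by
    simp [ED, μD, mul_comm]
  rw [← ED_pow_card, ← hempty, ED, ED, ED, mul_sum, ← sum_sub_distrib]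
  refine sum_le_sum fun S _ => ?_
  have hμ : 0 ≤ μD n p S := mul_nonneg (pow_nonneg hp0 _) (pow_nonneg (sub_nonneg.2 hp1) _)
  rw [mul_left_comm (2 / (n : ℝ)), ← mul_sub]
  refine mul_le_mul_of_nonneg_left ?_ hμ
  have hbound : (S.card : ℝ) * n * (1 - S.card) ^ 2 ≤ 2 / n * n ^ S.card := by
    have h := mul_sub_one_sq_mul_sq_le_pow hn' S.card
    rw [div_mul_eq_mul_div, le_div_iff₀ (by linarith)]
    linarith
  have hcov := mul_le_mul_of_nonneg_right (coveredCount_le n S) (sq_nonneg (1 - (S.card : ℝ)))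
  split_ifs with hS
  · subst hS
    simp only [card_empty, Nat.cast_zero] at hcov hbound ⊢
    linarith
  · have := mul_nonneg ht (sq_nonneg (1 - (S.card : ℝ)))
    linarith

lemma pval_le {n r t : ℕ} (hn : 4 * r + 4 ≤ n) : pval n r t ≤ 16 * t / (n : ℝ) ^ 2 := by
  have hn0 : (0 : ℝ) < n := by exact_mod_cast (by omega : 0 < n)
  have hn' : (4 * r + 4 : ℝ) ≤ n := by exact_mod_cast hn
  have hc : (n : ℝ) ^ 2 / 16 ≤ ((n - 2 * r).choose 2 : ℝ) := by
    rw [Nat.cast_choose_two, Nat.cast_sub (by omega)]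
    push_cast
    nlinarith
  rw [pval, mul_comm (16 : ℝ), ← div_div_eq_mul_div]
  exact div_le_div_of_nonneg_left t.cast_nonneg (by positivity) hc

theorem stmt11 (r t : ℕ) (ht : 1 ≤ t) :
    ∃ N0 : ℕ, ∀ n : ℕ, N0 ≤ n →
      ¬ Matrix.PosSemidef (Matrix.of fun I J : {I : Finset (Fin n) // I.card ≤ 1} =>
          (∑ e : EdgeT n,
              yD n (pval n r t)
                ((I.1.image (Sum.inl : Fin n → PVar n)
                    ∪ J.1.image (Sum.inl : Fin n → PVar n)) ∪ {Sum.inr e}))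
            - (t : ℝ) * yD n (pval n r t)
                (I.1.image (Sum.inl : Fin n → PVar n)
                  ∪ J.1.image (Sum.inl : Fin n → PVar n))) := by
  refine ⟨4 * r + 6 + 32 * t + ⌈4 * Real.exp (16 * t)⌉₊ + 1, fun n hn hM => ?_⟩
  have ht1 : (1 : ℝ) ≤ t := by exact_mod_cast ht
  have hn32 : (32 * t : ℝ) ≤ n := by exact_mod_cast (by omega : 32 * t ≤ n)
  have hn1 : (1 : ℝ) ≤ n := by exact_mod_cast (by omega : 1 ≤ n)
  have hn0 : (0 : ℝ) < n := by linarith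
  have hexp : 4 * Real.exp (16 * t) < n := by
    refine (Nat.le_ceil _).trans_lt ?_
    exact_mod_cast (by omega : ⌈4 * Real.exp (16 * t)⌉₊ < n)
  have hp0 : 0 ≤ pval n r t := by unfold pval; positivity
  have hpn2 : pval n r t * (n : ℝ) ^ 2 ≤ 16 * t :=
    (le_div_iff₀ (by positivity)).1 (pval_le (by omega))
  have hquad := hM.dotProduct_mulVec_nonneg fun I => 1 - 2 * (I.1.card : ℝ)
  simp only [slack_entry_eq] at hquad
  generalize pval n r t = p at hp0 hpn2 hquad
  have hpn : n * p ≤ 1 / 2 := by nlinarith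
  have hp1 : p ≤ 1 := by nlinarith
  have hform : 0 ≤ ED n p (fun S => (coveredCount n S - t) * (1 - S.card) ^ 2) := by
    refine hquad.trans_eq ?_
    simp only [← sum_card_le_one_subset]
    exact quadratic_form_ED n p (fun S => coveredCount n S - t)
      (fun (I : {I : Finset (Fin n) // I.card ≤ 1}) S => if I.1 ⊆ S then 1 else 0)
      fun I => 1 - 2 * (I.1.card : ℝ)
  have hpow : (1 + p * (n - 1)) ^ n ≤ Real.exp (16 * t) := by
    have h1 : 0 ≤ 1 + p * (n - 1 : ℝ) := by nlinarith
    calc (1 + p * (n - 1 : ℝ)) ^ n ≤ Real.exp (p * (n - 1)) ^ n :=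
          pow_le_pow_left₀ h1 (by linarith [Real.add_one_le_exp (p * (n - 1 : ℝ))]) n
      _ = Real.exp (n * (p * (n - 1))) := (Real.exp_nat_mul _ n).symm
      _ ≤ Real.exp (16 * t) := Real.exp_le_exp.2 (by nlinarith)
  have hbern : 1 / 2 ≤ (1 - p) ^ n := by
    have := one_add_mul_le_pow (show (-2 : ℝ) ≤ -p by linarith) n
    rw [← sub_eq_add_neg] at this
    linarith
  have hsmall : 2 / n * (1 + p * (n - 1)) ^ n < 1 / 2 := by
    rw [div_mul_eq_mul_div, div_lt_iff₀ hn0]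
    linarith
  have hle := hform.trans (ED_slack_le (by omega) hp0 hp1 t.cast_nonneg)
  nlinarith

end
end

section
/- Let n ≥ 2 and 1 ≤ t ≤ C(n,2), and let K_n = (V,E) be the complete graph on n vertices. Then the minimum of ∑_{i∈V} x_i over all x in the t-partial-vertex-cover polytope P_t(K_n) equals t/(n−1). -/
open Finset
open scoped Classical

noncomputable section

/-- Membership in the `t`-partial-vertex-cover polytope `P_t(K_n)`. -/
def Pfeas (n t : ℕ) (x : PVar n → ℝ) : Prop :=
  (∀ (e : EdgeT n) (i j : Fin n), e.1 = s(i, j) →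
    x (Sum.inl i) + x (Sum.inl j) ≥ x (Sum.inr e)) ∧
  ((∑ e : EdgeT n, x (Sum.inr e)) ≥ (t : ℝ)) ∧
  (∀ q : PVar n, 0 ≤ x q ∧ x q ≤ 1)

lemma card_edges_containing_le (n : ℕ) (i : Fin n) :
    (univ.filter fun e : EdgeT n => i ∈ e.1).card ≤ n - 1 := by
  have hsub : (univ.filter fun e : EdgeT n => i ∈ e.1).map (Function.Embedding.subtype _) ⊆
      (univ.erase i).image fun j => s(i, j) := by
    intro e he
    obtain ⟨⟨e', hdiag⟩, hmem, rfl⟩ := mem_map.1 he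
    obtain ⟨j, rfl⟩ := (mem_filter.1 hmem).2
    refine mem_image.2 ⟨j, mem_erase.2 ⟨?_, mem_univ j⟩, rfl⟩
    rintro rfl
    exact hdiag rfl
  calc _ = _ := (card_map _).symm
    _ ≤ _ := card_le_card hsub
    _ ≤ _ := card_image_le
    _ = n - 1 := by rw [card_erase_of_mem (mem_univ i), card_univ, Fintype.card_fin]

lemma Pfeas.edge_le {n t : ℕ} {x : PVar n → ℝ} (hx : Pfeas n t x) (e : EdgeT n) :
    x (Sum.inr e) ≤ ∑ i : Fin n, if i ∈ e.1 then x (Sum.inl i) else 0 := by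
  obtain ⟨⟨i, j⟩, hdiag⟩ := e
  have hij : i ≠ j := hdiag
  have hfilter : (univ.filter fun k => k ∈ s(i, j)) = {i, j} := by
    ext k
    simp
  rw [← sum_filter]
  change _ ≤ ∑ k ∈ univ.filter (fun k => k ∈ s(i, j)), x (Sum.inl k)
  rw [hfilter, sum_pair hij]
  exact hx.1 _ i j rfl

lemma Pfeas.le_mul_sum {n t : ℕ} (hn : 1 ≤ n) {x : PVar n → ℝ} (hx : Pfeas n t x) :
    (t : ℝ) ≤ (∑ i : Fin n, x (Sum.inl i)) * ((n : ℝ) - 1) := by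
  calc (t : ℝ) ≤ ∑ e : EdgeT n, x (Sum.inr e) := hx.2.1
    _ ≤ ∑ e : EdgeT n, ∑ i : Fin n, if i ∈ e.1 then x (Sum.inl i) else 0 :=
      sum_le_sum fun e _ => hx.edge_le e
    _ = ∑ i : Fin n, ∑ e : EdgeT n, if i ∈ e.1 then x (Sum.inl i) else 0 := sum_comm
    _ ≤ ∑ i : Fin n, x (Sum.inl i) * ((n : ℝ) - 1) := by
      refine sum_le_sum fun i _ => ?_
      rw [← sum_filter, sum_const, nsmul_eq_mul, mul_comm]
      refine mul_le_mul_of_nonneg_left ?_ (hx.2.2 _).1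
      have h : ((univ.filter fun e : EdgeT n => i ∈ e.1).card : ℝ) ≤ ((n - 1 : ℕ) : ℝ) :=
        Nat.cast_le.2 (card_edges_containing_le n i)
      rwa [Nat.cast_sub hn, Nat.cast_one] at h
    _ = _ := (sum_mul ..).symm

lemma card_edgeT (n : ℕ) : Fintype.card (EdgeT n) = n.choose 2 := by
  have h := Sym2.card_subtype_not_diag (α := Fin n)
  rw [Fintype.card_fin] at h
  convert h

theorem stmt12 (n t : ℕ) (hn : 2 ≤ n) (ht1 : 1 ≤ t) (ht2 : t ≤ Nat.choose n 2) :
    IsLeast {v : ℝ | ∃ x : PVar n → ℝ, Pfeas n t x ∧ v = ∑ i : Fin n, x (Sum.inl i)}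
      ((t : ℝ) / ((n : ℝ) - 1)) := by
  have hn' : (2 : ℝ) ≤ n := by exact_mod_cast hn
  have hn1 : (0 : ℝ) < (n : ℝ) - 1 := by linarith
  have hn0 : (0 : ℝ) < n := by linarith
  constructor
  · have hchoose : ((n.choose 2 : ℕ) : ℝ) = n * ((n : ℝ) - 1) / 2 := Nat.cast_choose_two ℝ n
    have htle : (t : ℝ) ≤ n * ((n : ℝ) - 1) / 2 := by
      rw [← hchoose]
      exact_mod_cast ht2
    set c : ℝ := t / (n * ((n : ℝ) - 1)) with hc
    have hc0 : 0 ≤ c := by positivity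
    have hc1 : 2 * c ≤ 1 := by
      rw [hc, ← mul_div_assoc, div_le_one (by positivity)]
      linarith
    refine ⟨Sum.elim (fun _ => c) (fun _ => 2 * c), ⟨fun e i j _ => ?_, ?_, ?_⟩, ?_⟩
    · simp only [Sum.elim_inl, Sum.elim_inr]
      linarith
    · simp only [Sum.elim_inr, sum_const, card_univ, card_edgeT, nsmul_eq_mul, hchoose]
      refine le_of_eq ?_
      rw [hc]
      field_simp
    · rintro (i | e)
      · exact ⟨hc0, by simp only [Sum.elim_inl]; linarith⟩
      · exact ⟨by simp only [Sum.elim_inr]; linarith, hc1⟩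
    · simp only [Sum.elim_inl, sum_const, card_univ, Fintype.card_fin, nsmul_eq_mul]
      rw [hc]
      field_simp
  · rintro v ⟨x, hx, rfl⟩
    exact (div_le_iff₀ hn1).2 (hx.le_mul_sum (by omega))

end
end
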